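/- With 𝒜, Ā, and 𝒜^c = Ā − 𝒜 as defined, the identities 𝒜·𝒜ᵀ·Ā = 𝒜 and (I − 𝒜·𝒜ᵀ)·Ā = 𝒜^c hold. -/

import Mathlib

noncomputable section
open Matrix BigOperators Finset

/-- Kronecker product of complex matrices, with the big-endian index identification
`i = p·i₁ + i₂` (first factor is the high-order register). -/
def kron {m n p q : ℕ} (A : Matrix (Fin m) (Fin n) ℂ) (B : Matrix (Fin p) (Fin q) ℂ) :
    Matrix (Fin (m * p)) (Fin (n * q)) ℂ :=
  Matrix.of fun i j => A i.divNat j.divNat * B i.modNat j.modNat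

/-- `l`-fold Kronecker power `B^{⊗l}`. -/
def kronPow {n : ℕ} (B : Matrix (Fin n) (Fin n) ℂ) : (l : ℕ) → Matrix (Fin (n ^ l)) (Fin (n ^ l)) ℂ
  | 0 => 1
  | l + 1 => kron (kronPow B l) B

/-- Recast a matrix along equalities of its dimensions. -/
def mcast {a b c d : ℕ} (h1 : a = b) (h2 : c = d) (M : Matrix (Fin a) (Fin c) ℂ) :
    Matrix (Fin b) (Fin d) ℂ :=
  M.submatrix (Fin.cast h1.symm) (Fin.cast h2.symm)

/-- The commutation matrix `K^{(a,b)}`, the `ab × ab` permutation matrix determined by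
`K (x ⊗ y) = y ⊗ x`: column `b·x + y` has its unique `1` in row `a·y + x`. -/
def commMat (a b : ℕ) : Matrix (Fin (a * b)) (Fin (a * b)) ℂ :=
  Matrix.of fun i j => if (i : ℕ) = a * ((j : ℕ) % b) + (j : ℕ) / b then 1 else 0

/-- τ0, τ1, τ2, τ3. -/
def τ : Fin 4 → Matrix (Fin 2) (Fin 2) ℂ
  | 0 => !![1, 0; 0, 0]
  | 1 => !![0, 1; 0, 0]
  | 2 => !![0, 0; 1, 0]
  | 3 => !![0, 0; 0, 1]

/-- ρ0 = τ0, ρ1 = τ1, ρ2 = τ2, ρ3 = τ3, ρ4 = I₂. -/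
def ρ : Fin 5 → Matrix (Fin 2) (Fin 2) ℂ
  | 0 => !![1, 0; 0, 0]
  | 1 => !![0, 1; 0, 0]
  | 2 => !![0, 0; 1, 0]
  | 3 => !![0, 0; 0, 1]
  | 4 => 1

def σx : Matrix (Fin 2) (Fin 2) ℂ := !![0, 1; 1, 0]

/-- ρ̄ = σx for ρ1, ρ2 and ρ̄ = I₂ for ρ0, ρ3, ρ4. -/
def ρbar : Fin 5 → Matrix (Fin 2) (Fin 2) ℂ
  | 0 => 1
  | 1 => σx
  | 2 => σx
  | 3 => 1
  | 4 => 1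

/-- The Kronecker product `f 0 ⊗ f 1 ⊗ ⋯ ⊗ f (Q−1)` of 2×2 matrices (leftmost factor
is the most significant register). -/
def kronSeq : (Q : ℕ) → (Fin Q → Matrix (Fin 2) (Fin 2) ℂ) → Matrix (Fin (2 ^ Q)) (Fin (2 ^ Q)) ℂ
  | 0, _ => 1
  | Q + 1, f => kron (kronSeq Q fun k => f k.castSucc) (f (Fin.last Q))

/-- A (real) permutation matrix: a 0/1 matrix with exactly one 1 in each row and column. -/
def IsPermMatrix {N : ℕ} (M : Matrix (Fin N) (Fin N) ℂ) : Prop :=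
  (∀ i j, M i j = 0 ∨ M i j = 1) ∧ (∀ i, ∃! j, M i j = 1) ∧ (∀ j, ∃! i, M i j = 1)

/-- 𝒟 = τ0^{⊗s} ⊗ I_{n_x}, where n_x = 2^s. -/
def Dmat (s : ℕ) : Matrix (Fin ((2 ^ s) ^ 2)) (Fin ((2 ^ s) ^ 2)) ℂ :=
  mcast (by ring) (by ring) (kron (kronPow (τ 0) s) (1 : Matrix (Fin (2 ^ s)) (Fin (2 ^ s)) ℂ))

/-- The middle factor (τ0^{⊗s} ⊗ K^{(n_x^l,n_x)}) · (𝒟P ⊗ I_{n_x}^{⊗l}) · K^{(n_x²,n_x^l)}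
of 𝒜. -/
def midA (s l : ℕ) (P : Matrix (Fin ((2 ^ s) ^ 2)) (Fin ((2 ^ s) ^ 2)) ℂ) :
    Matrix (Fin ((2 ^ s) ^ (l + 2))) (Fin ((2 ^ s) ^ (l + 2))) ℂ :=
  mcast (by ring) (by ring) (kron (kronPow (τ 0) s) (commMat ((2 ^ s) ^ l) (2 ^ s))) *
    mcast (by ring) (by ring)
      (kron (Dmat s * P) (1 : Matrix (Fin ((2 ^ s) ^ l)) (Fin ((2 ^ s) ^ l)) ℂ)) *
    mcast (by ring) (by ring) (commMat ((2 ^ s) ^ 2) ((2 ^ s) ^ l))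

/-- The middle factor (I_{n_x} ⊗ K^{(n_x^l,n_x)}) · (P ⊗ I_{n_x}^{⊗l}) · K^{(n_x²,n_x^l)}
of Ā. -/
def midAbar (s l : ℕ) (P : Matrix (Fin ((2 ^ s) ^ 2)) (Fin ((2 ^ s) ^ 2)) ℂ) :
    Matrix (Fin ((2 ^ s) ^ (l + 2))) (Fin ((2 ^ s) ^ (l + 2))) ℂ :=
  mcast (by ring) (by ring)
      (kron (1 : Matrix (Fin (2 ^ s)) (Fin (2 ^ s)) ℂ) (commMat ((2 ^ s) ^ l) (2 ^ s))) *
    mcast (by ring) (by ring) (kron P (1 : Matrix (Fin ((2 ^ s) ^ l)) (Fin ((2 ^ s) ^ l)) ℂ)) *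
    mcast (by ring) (by ring) (commMat ((2 ^ s) ^ 2) ((2 ^ s) ^ l))

/-- 𝒜 = (ρ_{r_0} ⊗ ⋯ ⊗ ρ_{r_{Q1−1}}) ⊗
  [(τ0^{⊗s} ⊗ K^{(n_x^l,n_x)}) · (𝒟P ⊗ I_{n_x}^{⊗l}) · K^{(n_x²,n_x^l)}] ⊗ I_{n_x}^{⊗(j−l−1)}. -/
def Afull (s Q1 l j : ℕ) (r : Fin Q1 → Fin 5)
    (P : Matrix (Fin ((2 ^ s) ^ 2)) (Fin ((2 ^ s) ^ 2)) ℂ) :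
    Matrix (Fin (2 ^ Q1 * ((2 ^ s) ^ (l + 2) * (2 ^ s) ^ (j - l - 1))))
      (Fin (2 ^ Q1 * ((2 ^ s) ^ (l + 2) * (2 ^ s) ^ (j - l - 1)))) ℂ :=
  kron (kronSeq Q1 fun k => ρ (r k))
    (kron (midA s l P) (kronPow (1 : Matrix (Fin (2 ^ s)) (Fin (2 ^ s)) ℂ) (j - l - 1)))

/-- Ā = (ρ̄_{r_0} ⊗ ⋯ ⊗ ρ̄_{r_{Q1−1}}) ⊗
  [(I_{n_x} ⊗ K^{(n_x^l,n_x)}) · (P ⊗ I_{n_x}^{⊗l}) · K^{(n_x²,n_x^l)}] ⊗ I_{n_x}^{⊗(j−l−1)}. -/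
def Abarfull (s Q1 l j : ℕ) (r : Fin Q1 → Fin 5)
    (P : Matrix (Fin ((2 ^ s) ^ 2)) (Fin ((2 ^ s) ^ 2)) ℂ) :
    Matrix (Fin (2 ^ Q1 * ((2 ^ s) ^ (l + 2) * (2 ^ s) ^ (j - l - 1))))
      (Fin (2 ^ Q1 * ((2 ^ s) ^ (l + 2) * (2 ^ s) ^ (j - l - 1)))) ℂ :=
  kron (kronSeq Q1 fun k => ρbar (r k))
    (kron (midAbar s l P) (kronPow (1 : Matrix (Fin (2 ^ s)) (Fin (2 ^ s)) ℂ) (j - l - 1)))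

open scoped Kronecker

theorem kron_eq_submatrix {m n p q : ℕ} (A : Matrix (Fin m) (Fin n) ℂ)
    (B : Matrix (Fin p) (Fin q) ℂ) :
    kron A B = (A ⊗ₖ B).submatrix finProdFinEquiv.symm finProdFinEquiv.symm := rfl

theorem kron_mul_kron {m n k p q t : ℕ} (A : Matrix (Fin m) (Fin n) ℂ)
    (B : Matrix (Fin p) (Fin q) ℂ) (C : Matrix (Fin n) (Fin k) ℂ)
    (D : Matrix (Fin q) (Fin t) ℂ) :
    kron A B * kron C D = kron (A * C) (B * D) := by
  simp only [kron_eq_submatrix, submatrix_mul_equiv, mul_kronecker_mul]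

theorem transpose_kron {m n p q : ℕ} (A : Matrix (Fin m) (Fin n) ℂ)
    (B : Matrix (Fin p) (Fin q) ℂ) : (kron A B)ᵀ = kron Aᵀ Bᵀ := rfl

theorem kron_one_one (m n : ℕ) :
    kron (1 : Matrix (Fin m) (Fin m) ℂ) (1 : Matrix (Fin n) (Fin n) ℂ) = 1 := by
  simp only [kron_eq_submatrix, one_kronecker_one, submatrix_one_equiv]

theorem kron_mul_transpose_mul_kron {m n k p q t : ℕ} (A : Matrix (Fin m) (Fin n) ℂ)
    (B : Matrix (Fin p) (Fin q) ℂ) (C : Matrix (Fin m) (Fin k) ℂ)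
    (D : Matrix (Fin p) (Fin t) ℂ) :
    kron A B * (kron A B)ᵀ * kron C D = kron (A * Aᵀ * C) (B * Bᵀ * D) := by
  simp only [transpose_kron, kron_mul_kron]

theorem mcast_mul_mcast {a b c d e f : ℕ} (h₁ : a = b) (h₂ : c = d) (h₃ : e = f)
    (M : Matrix (Fin a) (Fin c) ℂ) (N : Matrix (Fin c) (Fin e) ℂ) :
    mcast h₁ h₂ M * mcast h₂ h₃ N = mcast h₁ h₃ (M * N) := by
  subst h₁ h₂ h₃; rfl

theorem transpose_mcast {a b c d : ℕ} (h₁ : a = b) (h₂ : c = d)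
    (M : Matrix (Fin a) (Fin c) ℂ) : (mcast h₁ h₂ M)ᵀ = mcast h₂ h₁ Mᵀ := rfl

theorem mcast_one {a b : ℕ} (h : a = b) : mcast h h (1 : Matrix (Fin a) (Fin a) ℂ) = 1 := by
  subst h; rfl

theorem mcast_mul_transpose_self {a b : ℕ} (h : a = b) {M : Matrix (Fin a) (Fin a) ℂ}
    (hM : M * Mᵀ = 1) : mcast h h M * (mcast h h M)ᵀ = 1 := by
  rw [transpose_mcast, mcast_mul_mcast, hM, mcast_one]

theorem kron_mul_transpose_self {m n : ℕ} {A : Matrix (Fin m) (Fin m) ℂ}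
    {B : Matrix (Fin n) (Fin n) ℂ} (hA : A * Aᵀ = 1) (hB : B * Bᵀ = 1) :
    kron A B * (kron A B)ᵀ = 1 := by
  rw [transpose_kron, kron_mul_kron, hA, hB, kron_one_one]

theorem mul_mul_transpose_self {n : ℕ} {A B : Matrix (Fin n) (Fin n) ℂ}
    (hA : A * Aᵀ = 1) (hB : B * Bᵀ = 1) : (A * B) * (A * B)ᵀ = 1 := by
  rw [transpose_mul, Matrix.mul_assoc, ← Matrix.mul_assoc B, hB, Matrix.one_mul, hA]

theorem mcast_kron_one_congr {m p q N : ℕ} (hpq : p = q) (h₁ : m * p = N) (h₂ : m * q = N)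
    (A : Matrix (Fin m) (Fin m) ℂ) :
    mcast h₁ h₁ (kron A (1 : Matrix (Fin p) (Fin p) ℂ)) =
      mcast h₂ h₂ (kron A (1 : Matrix (Fin q) (Fin q) ℂ)) := by
  subst hpq; rfl

/-- Associativity of `kron`, up to recasting, on identity right factors. -/
theorem mcast_kron_mcast_kron_one {m n p a N : ℕ} (h₁ : m * n = a) (h₂ : a * p = N)
    (h₃ : m * (n * p) = N) (A : Matrix (Fin m) (Fin m) ℂ) :
    mcast h₂ h₂ (kron (mcast h₁ h₁ (kron A (1 : Matrix (Fin n) (Fin n) ℂ)))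
      (1 : Matrix (Fin p) (Fin p) ℂ)) =
    mcast h₃ h₃ (kron A (1 : Matrix (Fin (n * p)) (Fin (n * p)) ℂ)) := by
  subst h₁ h₂
  have h_div (i : Fin (m * n * p)) :
      (Fin.cast h₃.symm i).divNat = i.divNat.divNat :=
    Fin.ext (by simp [Fin.divNat, Nat.div_div_eq_div_mul, Nat.mul_comm])
  have h_div_mod (i : Fin (m * n * p)) :
      (Fin.cast h₃.symm i).modNat.divNat = i.divNat.modNat :=
    Fin.ext (by simp [Fin.divNat, Fin.modNat, Nat.mul_comm n p, Nat.mod_mul_right_div_self])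
  have h_mod_mod (i : Fin (m * n * p)) :
      (Fin.cast h₃.symm i).modNat.modNat = i.modNat :=
    Fin.ext (by simp [Fin.modNat])
  ext i j
  rw [← kron_one_one n p]
  change A i.divNat.divNat j.divNat.divNat * (1 : Matrix (Fin n) (Fin n) ℂ) i.divNat.modNat
      j.divNat.modNat * (1 : Matrix (Fin p) (Fin p) ℂ) i.modNat j.modNat =
    A (Fin.cast h₃.symm i).divNat (Fin.cast h₃.symm j).divNat *
      ((1 : Matrix (Fin n) (Fin n) ℂ) (Fin.cast h₃.symm i).modNat.divNat
        (Fin.cast h₃.symm j).modNat.divNat *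
      (1 : Matrix (Fin p) (Fin p) ℂ) (Fin.cast h₃.symm i).modNat.modNat
        (Fin.cast h₃.symm j).modNat.modNat)
  rw [h_div i, h_div j, h_div_mod i, h_div_mod j, h_mod_mod i, h_mod_mod j, mul_assoc]

theorem commMat_mul_transpose_self (a b : ℕ) : commMat a b * (commMat a b)ᵀ = 1 := by
  let e : Fin (a * b) ≃ Fin (a * b) := finProdFinEquiv.symm.trans
    ((Equiv.prodComm _ _).trans (finProdFinEquiv.trans (finCongr (Nat.mul_comm b a))))
  have he : commMat a b = (1 : Matrix (Fin (a * b)) (Fin (a * b)) ℂ).submatrix id e := by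
    ext i j
    have hj : (e j : ℕ) = a * ((j : ℕ) % b) + (j : ℕ) / b := by
      simp [e, finProdFinEquiv, Nat.add_comm]
    simp only [commMat, of_apply, submatrix_apply, id, one_apply, Fin.ext_iff, hj]
  rw [he, transpose_submatrix, submatrix_mul_equiv, transpose_one, Matrix.one_mul, submatrix_id_id]

theorem IsPermMatrix.mul_transpose_self {N : ℕ} {P : Matrix (Fin N) (Fin N) ℂ}
    (hP : IsPermMatrix P) : P * Pᵀ = 1 := by
  obtain ⟨h01, hrow, hcol⟩ := hP
  ext i k
  obtain ⟨j₀, hj₀, huniq⟩ := hrow i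
  have hz (j : Fin N) (hj : j ≠ j₀) : P i j = 0 :=
    (h01 i j).resolve_right fun h => hj (huniq j h)
  rw [mul_apply, Finset.sum_eq_single j₀ (fun j _ hj => by rw [hz j hj, zero_mul]) (by simp),
    hj₀, one_mul, transpose_apply, one_apply]
  split_ifs with hik
  · rw [← hik, hj₀]
  · exact (h01 k j₀).resolve_right fun h => hik ((hcol j₀).unique hj₀ h)

theorem kronPow_one (n l : ℕ) : kronPow (1 : Matrix (Fin n) (Fin n) ℂ) l = 1 := by
  induction l with
  | zero => rfl
  | succ l ih => rw [kronPow, ih]; exact kron_one_one _ _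

theorem kronPow_mul_kronPow {n : ℕ} (B C : Matrix (Fin n) (Fin n) ℂ) (l : ℕ) :
    kronPow B l * kronPow C l = kronPow (B * C) l := by
  induction l with
  | zero => exact Matrix.one_mul _
  | succ l ih => exact (kron_mul_kron _ _ _ _).trans (by rw [ih]; rfl)

theorem transpose_kronPow {n : ℕ} (B : Matrix (Fin n) (Fin n) ℂ) (l : ℕ) :
    (kronPow B l)ᵀ = kronPow Bᵀ l := by
  induction l with
  | zero => exact transpose_one
  | succ l ih => exact (transpose_kron _ _).trans (by rw [ih]; rfl)

theorem τ_zero_mul_self : τ 0 * τ 0 = τ 0 := by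
  ext i j
  fin_cases i <;> fin_cases j <;> simp only [mul_apply, Fin.sum_univ_two] <;> simp [τ]

theorem transpose_τ_zero : (τ 0)ᵀ = τ 0 := by
  ext i j; fin_cases i <;> fin_cases j <;> rfl

theorem ρ_mul_transpose_mul_ρbar (k : Fin 5) : ρ k * (ρ k)ᵀ * ρbar k = ρ k := by
  fin_cases k <;> ext i j <;> fin_cases i <;> fin_cases j <;>
    simp only [mul_apply, transpose_apply, Fin.sum_univ_two] <;> simp [ρ, ρbar, σx, one_apply]

theorem kronSeq_mul_transpose_mul {Q : ℕ} {f g : Fin Q → Matrix (Fin 2) (Fin 2) ℂ}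
    (h : ∀ k, f k * (f k)ᵀ * g k = f k) :
    kronSeq Q f * (kronSeq Q f)ᵀ * kronSeq Q g = kronSeq Q f := by
  induction Q with
  | zero => simp [kronSeq]
  | succ Q ih =>
    exact (kron_mul_transpose_mul_kron _ _ _ _).trans
      (by rw [h, ih fun k => h k.castSucc]; rfl)

theorem midAbar_mul_transpose_self (s l : ℕ)
    {P : Matrix (Fin ((2 ^ s) ^ 2)) (Fin ((2 ^ s) ^ 2)) ℂ} (hP : IsPermMatrix P) :
    midAbar s l P * (midAbar s l P)ᵀ = 1 :=
  mul_mul_transpose_self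
    (mul_mul_transpose_self
      (mcast_mul_transpose_self _
        (kron_mul_transpose_self (by simp) (commMat_mul_transpose_self _ _)))
      (mcast_mul_transpose_self _ (kron_mul_transpose_self hP.mul_transpose_self (by simp))))
    (mcast_mul_transpose_self _ (commMat_mul_transpose_self _ _))

/-- The projection `τ0^{⊗s} ⊗ I` that cuts `midAbar` down to `midA`. -/
def midProj (s l : ℕ) : Matrix (Fin ((2 ^ s) ^ (l + 2))) (Fin ((2 ^ s) ^ (l + 2))) ℂ :=
  mcast (by ring) (by ring) (kron (kronPow (τ 0) s)
    (1 : Matrix (Fin ((2 ^ s) ^ l * 2 ^ s)) (Fin ((2 ^ s) ^ l * 2 ^ s)) ℂ))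

theorem midProj_mul_transpose_self (s l : ℕ) :
    midProj s l * (midProj s l)ᵀ = midProj s l := by
  simp only [midProj, transpose_mcast, mcast_mul_mcast, transpose_kron, kron_mul_kron,
    transpose_kronPow, kronPow_mul_kronPow, transpose_τ_zero, τ_zero_mul_self, transpose_one,
    Matrix.one_mul]

theorem mcast_kron_Dmat_one (s l : ℕ) (h : (2 ^ s) ^ 2 * (2 ^ s) ^ l = (2 ^ s) ^ (l + 2)) :
    mcast h h (kron (Dmat s) (1 : Matrix (Fin ((2 ^ s) ^ l)) (Fin ((2 ^ s) ^ l)) ℂ)) =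
      midProj s l := by
  have h' : 2 ^ s * (2 ^ s * (2 ^ s) ^ l) = (2 ^ s) ^ (l + 2) := by ring
  rw [Dmat, mcast_kron_mcast_kron_one _ h h', midProj]
  exact mcast_kron_one_congr (Nat.mul_comm _ _) _ _ _

theorem midA_eq_midProj_mul_midAbar (s l : ℕ)
    (P : Matrix (Fin ((2 ^ s) ^ 2)) (Fin ((2 ^ s) ^ 2)) ℂ) :
    midA s l P = midProj s l * midAbar s l P := by
  have hT : kronPow (τ 0) s * kronPow (τ 0) s = kronPow (τ 0) s := by
    rw [kronPow_mul_kronPow, τ_zero_mul_self]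
  have h : (2 ^ s) ^ 2 * (2 ^ s) ^ l = (2 ^ s) ^ (l + 2) := by ring
  rw [midA, midAbar,
    show kron (Dmat s * P) (1 : Matrix (Fin ((2 ^ s) ^ l)) (Fin ((2 ^ s) ^ l)) ℂ) =
      kron (Dmat s) 1 * kron P 1 by rw [kron_mul_kron, Matrix.one_mul],
    ← mcast_mul_mcast _ h, mcast_kron_Dmat_one]
  simp only [← Matrix.mul_assoc]
  congr 2
  simp only [midProj, mcast_mul_mcast, kron_mul_kron, hT, Matrix.one_mul, Matrix.mul_one]

theorem midA_mul_transpose_mul_midAbar (s l : ℕ)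
    {P : Matrix (Fin ((2 ^ s) ^ 2)) (Fin ((2 ^ s) ^ 2)) ℂ} (hP : IsPermMatrix P) :
    midA s l P * (midA s l P)ᵀ * midAbar s l P = midA s l P := by
  rw [midA_eq_midProj_mul_midAbar, transpose_mul, Matrix.mul_assoc (midProj s l),
    ← Matrix.mul_assoc (midAbar s l P), midAbar_mul_transpose_self s l hP, Matrix.one_mul,
    midProj_mul_transpose_self]

theorem Afull_mul_transpose_mul_Abarfull (s Q1 l j : ℕ) (r : Fin Q1 → Fin 5)
    {P : Matrix (Fin ((2 ^ s) ^ 2)) (Fin ((2 ^ s) ^ 2)) ℂ} (hP : IsPermMatrix P) :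
    Afull s Q1 l j r P * (Afull s Q1 l j r P)ᵀ * Abarfull s Q1 l j r P = Afull s Q1 l j r P := by
  rw [Afull, Abarfull, kron_mul_transpose_mul_kron, kron_mul_transpose_mul_kron,
    kronSeq_mul_transpose_mul fun k => ρ_mul_transpose_mul_ρbar (r k),
    midA_mul_transpose_mul_midAbar s l hP]
  simp only [kronPow_one, transpose_one, Matrix.one_mul]

/-- With 𝒜, Ā, and 𝒜^c = Ā − 𝒜 as defined, the identities
𝒜·𝒜ᵀ·Ā = 𝒜 and (I − 𝒜·𝒜ᵀ)·Ā = 𝒜^c hold. -/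
theorem statement3 (s Q1 l j : ℕ) (hs : 1 ≤ s) (hjl : l + 1 ≤ j) (r : Fin Q1 → Fin 5)
    (P : Matrix (Fin ((2 ^ s) ^ 2)) (Fin ((2 ^ s) ^ 2)) ℂ) (hP : IsPermMatrix P) :
    let 𝒜 := Afull s Q1 l j r P
    let Abar := Abarfull s Q1 l j r P
    𝒜 * 𝒜ᵀ * Abar = 𝒜 ∧ (1 - 𝒜 * 𝒜ᵀ) * Abar = Abar - 𝒜 := by
  intro 𝒜 Abar
  have h : 𝒜 * 𝒜ᵀ * Abar = 𝒜 := Afull_mul_transpose_mul_Abarfull s Q1 l j r hP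
  exact ⟨h, by rw [Matrix.sub_mul, Matrix.one_mul, h]⟩
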